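/- arXiv:2111.11801 — 2 statements merged into one kernel-verified Lean document; each statement's English description precedes it below -/
import Mathlib

section
/- Let X ∈ ℝ^{n×p}, y ∈ ℝⁿ, λ > 0, and let q: ℝ^p → ℝ be convex and differentiable. Define f(β) = (1/2)‖Xβ − y‖² + λ‖β‖₁ − q(β) and, for σ > 0 and β̄ ∈ ℝ^p, J(β; σ, β̄, ∇q(β̄)) = (1/2)‖Xβ − y‖² + λ‖β‖₁ − q(β̄) − ⟨∇q(β̄), β − β̄⟩ + (σ/2)‖β − β̄‖². Then β̄ ∈ ℝ^p is a d-stationary point of f if and only if there exists σ > 0 such that β̄ is a global minimizer of β ↦ J(β; σ, β̄, ∇q(β̄)) over ℝ^p. -/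
open Filter Topology

/-- Euclidean norm on `Fin m → ℝ`. -/
noncomputable def euclNorm {m : ℕ} (x : Fin m → ℝ) : ℝ := Real.sqrt (∑ i, (x i) ^ 2)

/-- ℓ₁ norm on `Fin m → ℝ`. -/
noncomputable def l1Norm {m : ℕ} (x : Fin m → ℝ) : ℝ := ∑ i, |x i|

/-- Euclidean inner product on `Fin m → ℝ`. -/
noncomputable def dotp {m : ℕ} (x y : Fin m → ℝ) : ℝ := ∑ i, x i * y i

/-- The continuous linear functional `v ↦ ⟨g, v⟩` on `Fin m → ℝ`. -/
noncomputable def dotCLM {m : ℕ} (g : Fin m → ℝ) : (Fin m → ℝ) →L[ℝ] ℝ :=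
  ∑ i, g i • ContinuousLinearMap.proj i

/-- The majorization `J(β; σ, β̄, ∇q(β̄))`. -/
noncomputable def Jmaj {n p : ℕ} (X : Matrix (Fin n) (Fin p) ℝ) (y : Fin n → ℝ)
    (lam sigma : ℝ) (q : (Fin p → ℝ) → ℝ) (g : (Fin p → ℝ) → (Fin p → ℝ))
    (βbar β : Fin p → ℝ) : ℝ :=
  (1 / 2) * (euclNorm (X.mulVec β - y)) ^ 2 + lam * l1Norm β - q βbar
    - dotp (g βbar) (β - βbar) + (sigma / 2) * (euclNorm (β - βbar)) ^ 2

lemma euclNorm_sq {m : ℕ} (x : Fin m → ℝ) : euclNorm x ^ 2 = ∑ i, (x i) ^ 2 :=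
  Real.sq_sqrt (Finset.sum_nonneg fun _ _ => sq_nonneg _)

lemma convexOn_l1Norm {m : ℕ} : ConvexOn ℝ Set.univ (l1Norm : (Fin m → ℝ) → ℝ) := by
  refine ⟨convex_univ, fun x _ y _ a b ha hb _ => ?_⟩
  simp only [l1Norm, smul_eq_mul, Finset.mul_sum, ← Finset.sum_add_distrib]
  refine Finset.sum_le_sum fun i _ => ?_
  simpa [abs_mul, abs_of_nonneg ha, abs_of_nonneg hb] using abs_add_le (a * x i) (b * y i)

lemma convexOn_euclNorm_sq {m : ℕ} :
    ConvexOn ℝ Set.univ (fun x : Fin m → ℝ => euclNorm x ^ 2) := by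
  refine ⟨convex_univ, fun x _ y _ a b ha hb hab => ?_⟩
  simp only [euclNorm_sq, smul_eq_mul, Finset.mul_sum, ← Finset.sum_add_distrib]
  refine Finset.sum_le_sum fun i _ => ?_
  simpa using (even_two.convexOn_pow (𝕜 := ℝ)).2
    (Set.mem_univ (x i)) (Set.mem_univ (y i)) ha hb hab

lemma convexOn_lasso {n p : ℕ} {lam : ℝ} (hlam : 0 ≤ lam) (X : Matrix (Fin n) (Fin p) ℝ)
    (y : Fin n → ℝ) :
    ConvexOn ℝ Set.univ
      (fun β => (1 / 2) * euclNorm (X.mulVec β - y) ^ 2 + lam * l1Norm β) := by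
  have h := convexOn_euclNorm_sq.comp_affineMap
    (X.mulVecLin.toAffineMap - AffineMap.const ℝ (Fin p → ℝ) y)
  exact (h.smul (by norm_num : (0 : ℝ) ≤ 1 / 2)).add (convexOn_l1Norm.smul hlam)

/-- A finite convex function has one-sided directional derivatives. -/
lemma ConvexOn.exists_tendsto_slope_zero_right {E : Type*} [AddCommGroup E] [Module ℝ E]
    {A : E → ℝ} (hA : ConvexOn ℝ Set.univ A) (x h : E) :
    ∃ L : ℝ, Tendsto (fun δ : ℝ => (A (x + δ • h) - A x) / δ) (𝓝[>] 0) (𝓝 L) := by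
  have hconv := hA.comp_affineMap (AffineMap.lineMap x (x + h) : ℝ →ᵃ[ℝ] E)
  rw [Set.preimage_univ] at hconv
  have hd := hconv.hasDerivWithinAt_rightDeriv_of_mem_interior (x := 0) (by simp)
  rw [hasDerivWithinAt_iff_tendsto_slope' (by simp)] at hd
  refine ⟨_, hd.congr fun δ => ?_⟩
  simp [slope_def_field, AffineMap.lineMap_apply, add_comm]

/-- Along a direction, the difference quotients of a convex function on `(0, 1]` are at most the
increment over the whole step. -/
lemma ConvexOn.slope_zero_le_sub {E : Type*} [AddCommGroup E] [Module ℝ E]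
    {A : E → ℝ} (hA : ConvexOn ℝ Set.univ A) (x h : E) {δ : ℝ} (hδ : 0 < δ) (hδ1 : δ ≤ 1) :
    (A (x + δ • h) - A x) / δ ≤ A (x + h) - A x := by
  have key := hA.2 (Set.mem_univ x) (Set.mem_univ (x + h)) (sub_nonneg.2 hδ1) hδ.le
    (sub_add_cancel 1 δ)
  have hx : (1 - δ) • x + δ • (x + h) = x + δ • h := by module
  rw [hx] at key
  simp only [smul_eq_mul] at key
  rw [div_le_iff₀ hδ]
  linarith

lemma dotCLM_apply {m : ℕ} (g v : Fin m → ℝ) : dotCLM g v = dotp g v := by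
  simp [dotCLM, dotp]

lemma dotp_smul {m : ℕ} (g v : Fin m → ℝ) (δ : ℝ) : dotp g (δ • v) = δ * dotp g v := by
  simp [← dotCLM_apply]

lemma euclNorm_smul_sq {m : ℕ} (v : Fin m → ℝ) (δ : ℝ) :
    euclNorm (δ • v) ^ 2 = δ ^ 2 * euclNorm v ^ 2 := by
  simp [euclNorm_sq, mul_pow, Finset.mul_sum]

/-- `β̄` is a d-stationary point of
`f(β) = (1/2)‖Xβ − y‖² + λ‖β‖₁ − q(β)` (with `q` convex differentiable with gradient `g`)
iff there exists `σ > 0` such that `β̄` globally minimizes `β ↦ J(β; σ, β̄, ∇q(β̄))`. -/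
theorem dStationary_iff_minimizer {n p : ℕ} (lam : ℝ) (hlam : 0 < lam)
    (X : Matrix (Fin n) (Fin p) ℝ) (y : Fin n → ℝ)
    (q : (Fin p → ℝ) → ℝ) (g : (Fin p → ℝ) → (Fin p → ℝ))
    (hqconv : ConvexOn ℝ Set.univ q)
    (hqdiff : ∀ β : Fin p → ℝ, HasFDerivAt q (dotCLM (g β)) β)
    (f : (Fin p → ℝ) → ℝ)
    (hf : ∀ β : Fin p → ℝ,
      f β = (1 / 2) * (euclNorm (X.mulVec β - y)) ^ 2 + lam * l1Norm β - q β)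
    (βbar : Fin p → ℝ) :
    (∀ h : Fin p → ℝ, ∃ D : ℝ, 0 ≤ D ∧
        Tendsto (fun δ : ℝ => (f (βbar + δ • h) - f βbar) / δ)
          (nhdsWithin 0 (Set.Ioi 0)) (nhds D)) ↔
      ∃ sigma : ℝ, 0 < sigma ∧ ∀ β : Fin p → ℝ,
        Jmaj X y lam sigma q g βbar βbar ≤ Jmaj X y lam sigma q g βbar β := by
  set A : (Fin p → ℝ) → ℝ :=
    fun β => (1 / 2) * euclNorm (X.mulVec β - y) ^ 2 + lam * l1Norm β with hAdef
  have hA : ConvexOn ℝ Set.univ A := convexOn_lasso hlam.le X y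
  have hfA : ∀ β, f β = A β - q β := hf
  have hJ : ∀ sigma β, Jmaj X y lam sigma q g βbar β
      = A β - q βbar - dotp (g βbar) (β - βbar) + sigma / 2 * euclNorm (β - βbar) ^ 2 :=
    fun _ _ => rfl
  have hJbar : ∀ sigma, Jmaj X y lam sigma q g βbar βbar = A βbar - q βbar := fun sigma => by
    simp [hJ, dotp, euclNorm_sq]
  have hq : ∀ h : Fin p → ℝ, Tendsto (fun δ : ℝ => (q (βbar + δ • h) - q βbar) / δ)
      (𝓝[>] 0) (𝓝 (dotp (g βbar) h)) := fun h => by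
    rw [← dotCLM_apply]
    refine ((hqdiff βbar).hasLineDerivAt h).tendsto_slope_zero_right.congr fun δ => ?_
    rw [smul_eq_mul, div_eq_inv_mul]
  constructor
  · refine fun hstat => ⟨1, one_pos, fun β => ?_⟩
    obtain ⟨D, hD, hlim⟩ := hstat (β - βbar)
    have hle : D + dotp (g βbar) (β - βbar) ≤ A β - A βbar := by
      refine le_of_tendsto (hlim.add (hq (β - βbar))) ?_
      filter_upwards [Ioc_mem_nhdsGT (zero_lt_one (α := ℝ))] with δ hδ
      have hs := hA.slope_zero_le_sub βbar (β - βbar) hδ.1 hδ.2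
      rw [add_sub_cancel] at hs
      refine le_of_eq_of_le ?_ hs
      rw [hfA, hfA]
      ring
    rw [hJbar, hJ]
    linarith [sq_nonneg (euclNorm (β - βbar))]
  · rintro ⟨sigma, -, hmin⟩ h
    obtain ⟨L, hL⟩ := hA.exists_tendsto_slope_zero_right βbar h
    refine ⟨L - dotp (g βbar) h, sub_nonneg.2 ?_, (hL.sub (hq h)).congr fun δ => ?_⟩
    · have hlow : Tendsto (fun δ : ℝ => dotp (g βbar) h - δ * (sigma / 2 * euclNorm h ^ 2))
          (𝓝[>] 0) (𝓝 (dotp (g βbar) h)) := by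
        refine tendsto_nhdsWithin_of_tendsto_nhds (Continuous.tendsto' (by fun_prop) _ _ (by simp))
      refine le_of_tendsto_of_tendsto hlow hL ?_
      filter_upwards [self_mem_nhdsWithin] with δ hδ
      have hm := hmin (βbar + δ • h)
      rw [hJbar, hJ, add_sub_cancel_left, dotp_smul, euclNorm_smul_sq] at hm
      rw [le_div_iff₀ hδ]
      linarith
    · rw [hfA, hfA]
      ring
end

section
/- Let λ > 0 and τ > 2. The function t ↦ q_scad(t; λ, τ) from ℝ to ℝ is differentiable at every t ∈ ℝ, with derivative equal to λ·sign(t) if |t| > λτ; sign(t)(|t| − λ)/(τ − 1) if λ < |t| ≤ λτ; and 0 if |t| ≤ λ; moreover, this derivative is a continuous function of t, so q_scad(·; λ, τ) is continuously differentiable on ℝ. -/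
/-- The function `q_scad(t; λ, τ)`. -/
noncomputable def qSCAD (lam tau t : ℝ) : ℝ :=
  if lam * tau < |t| then lam * |t| - lam ^ 2 * (tau + 1) / 2
  else if lam < |t| then (|t| - lam) ^ 2 / (2 * (tau - 1))
  else 0

/-- The claimed derivative of `q_scad(·; λ, τ)`. -/
noncomputable def qSCAD' (lam tau t : ℝ) : ℝ :=
  if lam * tau < |t| then lam * Real.sign t
  else if lam < |t| then Real.sign t * (|t| - lam) / (tau - 1)
  else 0

/-- The squared positive part is differentiable with derivative twice the positive part. -/
theorem hasDerivAt_max_zero_sq (x : ℝ) :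
    HasDerivAt (fun y : ℝ => max y 0 ^ 2) (2 * max x 0) x := by
  refine hasDerivAt_of_hasDerivAt_of_ne' (x := 0) (g := fun y : ℝ => 2 * max y 0)
    (fun y hy => ?_) (by fun_prop) (by fun_prop) x
  rcases hy.lt_or_gt with hy | hy
  · rw [max_eq_right hy.le, mul_zero]
    refine (hasDerivAt_const y (0 : ℝ)).congr_of_eventuallyEq ?_
    filter_upwards [gt_mem_nhds hy] with z hz
    simp [max_eq_right hz.le]
  · rw [max_eq_left hy.le]
    have hd : HasDerivAt (fun z : ℝ => z ^ 2) (2 * y) y := by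
      simpa using hasDerivAt_pow 2 y
    refine hd.congr_of_eventuallyEq ?_
    filter_upwards [lt_mem_nhds hy] with z hz
    simp [max_eq_left hz.le]

/-- `q_scad` as a combination of squared positive parts. -/
theorem qSCAD_eq_max {lam tau : ℝ} (hlam : 0 < lam) (htau : 1 < tau) (t : ℝ) :
    qSCAD lam tau t = (max (t - lam) 0 ^ 2 + max (-t - lam) 0 ^ 2
      - max (t - lam * tau) 0 ^ 2 - max (-t - lam * tau) 0 ^ 2) / (2 * (tau - 1)) := by
  have hlt : lam < lam * tau := lt_mul_of_one_lt_right hlam htau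
  have hne : tau - 1 ≠ 0 := (sub_pos.mpr htau).ne'
  rw [eq_div_iff (by positivity)]
  unfold qSCAD
  rcases le_total 0 t with ht | ht
  · rw [abs_of_nonneg ht, max_eq_right (by linarith : -t - lam ≤ 0),
      max_eq_right (by linarith : -t - lam * tau ≤ 0)]
    split_ifs with h₁ h₂
    · rw [max_eq_left (by linarith), max_eq_left (by linarith)]
      ring
    · rw [max_eq_left (by linarith), max_eq_right (by linarith)]
      field_simp
      ring
    · rw [max_eq_right (by linarith), max_eq_right (by linarith)]
      ring
  · rw [abs_of_nonpos ht, max_eq_right (by linarith : t - lam ≤ 0),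
      max_eq_right (by linarith : t - lam * tau ≤ 0)]
    split_ifs with h₁ h₂
    · rw [max_eq_left (by linarith), max_eq_left (by linarith)]
      ring
    · rw [max_eq_left (by linarith), max_eq_right (by linarith)]
      field_simp
      ring
    · rw [max_eq_right (by linarith), max_eq_right (by linarith)]
      ring

/-- The derivative of `q_scad` as a combination of positive parts. -/
theorem qSCAD'_eq_max {lam tau : ℝ} (hlam : 0 < lam) (htau : 1 < tau) (t : ℝ) :
    qSCAD' lam tau t = (max (t - lam) 0 - max (-t - lam) 0
      - max (t - lam * tau) 0 + max (-t - lam * tau) 0) / (tau - 1) := by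
  have hlt : lam < lam * tau := lt_mul_of_one_lt_right hlam htau
  have hne : tau - 1 ≠ 0 := (sub_pos.mpr htau).ne'
  rw [eq_div_iff hne]
  unfold qSCAD'
  rcases le_total 0 t with ht | ht
  · rw [abs_of_nonneg ht, max_eq_right (by linarith : -t - lam ≤ 0),
      max_eq_right (by linarith : -t - lam * tau ≤ 0)]
    split_ifs with h₁ h₂
    · rw [max_eq_left (by linarith), max_eq_left (by linarith),
        Real.sign_of_pos (by linarith)]
      ring
    · rw [max_eq_left (by linarith), max_eq_right (by linarith),
        Real.sign_of_pos (by linarith), div_mul_cancel₀ _ hne]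
      ring
    · rw [max_eq_right (by linarith), max_eq_right (by linarith)]
      ring
  · rw [abs_of_nonpos ht, max_eq_right (by linarith : t - lam ≤ 0),
      max_eq_right (by linarith : t - lam * tau ≤ 0)]
    split_ifs with h₁ h₂
    · rw [max_eq_left (by linarith), max_eq_left (by linarith),
        Real.sign_of_neg (by linarith)]
      ring
    · rw [max_eq_left (by linarith), max_eq_right (by linarith),
        Real.sign_of_neg (by linarith), div_mul_cancel₀ _ hne]
      ring
    · rw [max_eq_right (by linarith), max_eq_right (by linarith)]
      ring

/-- `q_scad(·; λ, τ)` is differentiable everywhere with derivative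
`λ·sign(t)` if `|t| > λτ`, `sign(t)(|t| − λ)/(τ − 1)` if `λ < |t| ≤ λτ`, and `0` if
`|t| ≤ λ`, and this derivative is continuous. -/
theorem qSCAD_continuously_differentiable (lam tau : ℝ) (hlam : 0 < lam) (htau : 2 < tau) :
    (∀ t : ℝ, HasDerivAt (qSCAD lam tau) (qSCAD' lam tau t) t) ∧
    Continuous (qSCAD' lam tau) := by
  have htau' : 1 < tau := by linarith
  constructor
  · intro t
    have hpos (c : ℝ) :
        HasDerivAt (fun s : ℝ => max (s - c) 0 ^ 2) (2 * max (t - c) 0 * 1) t :=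
      (hasDerivAt_max_zero_sq (t - c)).comp (h := fun s => s - c) t
        ((hasDerivAt_id' t).sub_const c)
    have hneg (c : ℝ) :
        HasDerivAt (fun s : ℝ => max (-s - c) 0 ^ 2) (2 * max (-t - c) 0 * -1) t :=
      (hasDerivAt_max_zero_sq (-t - c)).comp (h := fun s => -s - c) t
        ((hasDerivAt_neg' t).sub_const c)
    rw [funext (qSCAD_eq_max hlam htau'), qSCAD'_eq_max hlam htau']
    have hne : tau - 1 ≠ 0 := (sub_pos.mpr htau').ne'
    refine (((((hpos lam).add (hneg lam)).sub (hpos (lam * tau))).sub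
      (hneg (lam * tau))).div_const (2 * (tau - 1))).congr_deriv ?_
    field_simp
    ring
  · rw [funext (qSCAD'_eq_max hlam htau')]
    fun_prop
end
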